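/- Let ⟨·,·⟩ denote the Minkowski bilinear form on ℝ^{12}. There do not exist vectors K, Γ₀, Γ₁, Γ₂, N₀, …, N₈, F in ℝ^{12} such that: Γ₀, Γ₁, Γ₂, N₀, …, N₈ span ℝ^{12}; ⟨Γ₀,Γ₀⟩ = 2, ⟨Γ₁,Γ₁⟩ = ⟨Γ₂,Γ₂⟩ = −2, ⟨Γᵢ,Γⱼ⟩ = 0 for i ≠ j, ⟨Nᵢ,Nᵢ⟩ = −2, ⟨Nᵢ,Nⱼ⟩ = 0 for i ≠ j, ⟨Γᵢ,Nⱼ⟩ = 0; ⟨K,Nᵢ⟩ = 0 and ⟨K,Γᵢ⟩ = 2 for all i; ⟨F,K⟩ = −2; ⟨F,Γ₀⟩ + ⟨F,Γ₁⟩ + ⟨F,Γ₂⟩ = 12; and ⟨F,Γ₀⟩ = 2m for some integer m. -/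

import Mathlib

/-- The Minkowski (Lorentzian) bilinear form on `ℝ^{n+1}`:
`⟨x, y⟩ = x 0 * y 0 - ∑_{i=1}^{n} x i * y i`. -/
def mink (n : ℕ) (x y : Fin (n + 1) → ℝ) : ℝ :=
  x 0 * y 0 - ∑ i ∈ Finset.Ioi (0 : Fin (n + 1)), x i * y i

theorem mink_add_left (n : ℕ) (x y z : Fin (n + 1) → ℝ) :
    mink n (x + y) z = mink n x z + mink n y z := by
  simp only [mink, Pi.add_apply, add_mul, Finset.sum_add_distrib]; ring

theorem mink_smul_left (n : ℕ) (c : ℝ) (x z : Fin (n + 1) → ℝ) :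
    mink n (c • x) z = c * mink n x z := by
  simp only [mink, Pi.smul_apply, smul_eq_mul, mul_assoc, ← Finset.mul_sum]; ring

theorem mink_comm (n : ℕ) (x y : Fin (n + 1) → ℝ) : mink n x y = mink n y x := by
  simp only [mink, mul_comm]

theorem mink_nondeg (n : ℕ) (v : Fin (n + 1) → ℝ) (h : ∀ w, mink n w v = 0) : v = 0 := by
  funext i
  have := h (Pi.single i 1)
  by_cases hi : i = 0
  · subst hi
    unfold mink at this
    rw [Finset.sum_eq_zero] at this
    · simpa using this
    · intro j hj
      have : j ≠ 0 := (Finset.mem_Ioi.1 hj).ne'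
      simp [this]
  · unfold mink at this
    rw [Finset.sum_eq_single i] at this
    · simpa [Pi.single_apply, Ne.symm hi] using this
    · intro j _ hj
      simp [hj]
    · intro hj
      exact absurd (Finset.mem_Ioi.2 (Fin.pos_of_ne_zero hi)) hj

/-- Exclusion of case (h) for `k = 9`. -/
theorem exclusion_case_h :
    ¬ ∃ (K Γ₀ Γ₁ Γ₂ : Fin 12 → ℝ) (N : Fin 9 → Fin 12 → ℝ) (F : Fin 12 → ℝ) (m : ℤ),
      Submodule.span ℝ ({Γ₀, Γ₁, Γ₂} ∪ Set.range N) = ⊤ ∧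
      mink 11 Γ₀ Γ₀ = 2 ∧ mink 11 Γ₁ Γ₁ = -2 ∧ mink 11 Γ₂ Γ₂ = -2 ∧
      mink 11 Γ₀ Γ₁ = 0 ∧ mink 11 Γ₀ Γ₂ = 0 ∧ mink 11 Γ₁ Γ₂ = 0 ∧
      (∀ i, mink 11 (N i) (N i) = -2) ∧
      (∀ i j, i ≠ j → mink 11 (N i) (N j) = 0) ∧
      (∀ j, mink 11 Γ₀ (N j) = 0 ∧ mink 11 Γ₁ (N j) = 0 ∧ mink 11 Γ₂ (N j) = 0) ∧
      (∀ i, mink 11 K (N i) = 0) ∧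
      mink 11 K Γ₀ = 2 ∧ mink 11 K Γ₁ = 2 ∧ mink 11 K Γ₂ = 2 ∧
      mink 11 F K = -2 ∧
      mink 11 F Γ₀ + mink 11 F Γ₁ + mink 11 F Γ₂ = 12 ∧
      mink 11 F Γ₀ = 2 * (m : ℝ) := by
  rintro ⟨K, A, B, C, N, F, m, hs, hAA, hBB, hCC, hAB, hAC, hBC, -, -, hN, hKN, hKA, hKB, hKC,
    hFK, hsum, hm⟩
  have key : ∀ w, mink 11 (K + (-1 : ℝ) • A + B + C) w
      = mink 11 K w - mink 11 A w + mink 11 B w + mink 11 C w := by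
    intro w
    simp only [mink_add_left, mink_smul_left]; ring
  have hv : K + (-1 : ℝ) • A + B + C = 0 := by
    apply mink_nondeg 11
    intro w
    have hw : w ∈ Submodule.span ℝ ({A, B, C} ∪ Set.range N) := hs ▸ Submodule.mem_top
    induction hw using Submodule.span_induction with
    | mem x hx =>
      rw [mink_comm, key]
      rcases hx with (rfl | rfl | rfl) | ⟨j, rfl⟩
      · rw [mink_comm 11 B, mink_comm 11 C]; linarith
      · rw [mink_comm 11 C]; linarith
      · linarith
      · obtain ⟨h1, h2, h3⟩ := hN j
        linarith [hKN j]
    | zero => simp [mink]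
    | add x y _ _ hx hy => rw [mink_add_left, hx, hy, add_zero]
    | smul c x _ hx => rw [mink_smul_left, hx, mul_zero]
  have h0 := key F
  rw [hv, mink_comm 11 K, mink_comm 11 A, mink_comm 11 B, mink_comm 11 C] at h0
  have hz : mink 11 0 F = 0 := by simp [mink]
  have h5 : (2 * (m : ℝ)) = 5 := by linarith
  have h6 : 2 * m = 5 := by exact_mod_cast h5
  omega
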